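/- Let G be a finite simple graph and W a minimal vertex cover of G, and let p = ⟨J_s(W)⟩, which is a prime ideal of J_sR. Then the contraction of the extension of J_s(I(G)) in the localization of J_sR at p equals p itself: φ_p^{-1}( J_s(I(G)) · (J_sR)_p ) = ⟨J_s(W)⟩, where φ_p : J_sR → (J_sR)_p is the canonical localization map. In other words, ⟨J_s(W)⟩ is the primary component of J_s(I(G)) corresponding to the minimal prime ⟨J_s(W)⟩. -/

import Mathlib

open MvPolynomial

/-- `W` is a vertex cover of `G`. -/
def IsVertexCover {V : Type*} (G : SimpleGraph V) (W : Set V) : Prop :=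
  ∀ ⦃x y : V⦄, G.Adj x y → x ∈ W ∨ y ∈ W

/-- `W` is a minimal vertex cover of `G`. -/
def IsMinimalVertexCover {V : Type*} (G : SimpleGraph V) (W : Set V) : Prop :=
  IsVertexCover G W ∧ ∀ W' : Set V, W' ⊂ W → ¬ IsVertexCover G W'

/-- The degree `m` part `α_m(x,y) = ∑_{i+j=m} X(x,i)·X(y,j)` of the image of the
edge monomial `xy` in the ring of `s`-jets. -/
noncomputable def jetsAlpha (k : Type*) [Field k] {V : Type*} (s : ℕ) (x y : V) (m : ℕ) :
    MvPolynomial (V × Fin (s + 1)) k :=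
  ∑ ij ∈ Finset.univ.filter
      (fun ij : Fin (s + 1) × Fin (s + 1) => (ij.1 : ℕ) + (ij.2 : ℕ) = m),
    X (x, ij.1) * X (y, ij.2)

/-- The `s`-jets `J_s(I(G))` of the edge ideal of `G`. -/
noncomputable def jetsEdgeIdeal (k : Type*) [Field k] {V : Type*} (G : SimpleGraph V)
    (s : ℕ) : Ideal (MvPolynomial (V × Fin (s + 1)) k) :=
  Ideal.span {f | ∃ x y : V, G.Adj x y ∧ ∃ m ≤ s, f = jetsAlpha k s x y m}

/-- `⟨J_s(W)⟩`: the ideal generated by the jets variables of the elements of `W`. -/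
noncomputable def jetsVertexCoverIdeal (k : Type*) [Field k] {V : Type*} (s : ℕ)
    (W : Set V) : Ideal (MvPolynomial (V × Fin (s + 1)) k) :=
  Ideal.span {f | ∃ x ∈ W, ∃ i : Fin (s + 1), f = X (x, i)}

theorem IsMinimalVertexCover.exists_adj_notMem {V : Type*} {G : SimpleGraph V} {W : Set V}
    (hW : IsMinimalVertexCover G W) {x : V} (hx : x ∈ W) : ∃ y, G.Adj x y ∧ y ∉ W := by
  by_contra! h
  refine hW.2 (W \ {x}) (Set.sdiff_singleton_ssubset.2 hx) fun a b hab => ?_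
  by_cases ha : a = x
  · subst ha
    exact Or.inr ⟨h b hab, hab.ne'⟩
  by_cases hb : b = x
  · subst hb
    exact Or.inl ⟨h a hab.symm, ha⟩
  exact (hW.1 hab).imp (fun h' => ⟨h', ha⟩) fun h' => ⟨h', hb⟩

theorem jetsEdgeIdeal_le_jetsVertexCoverIdeal (k : Type*) [Field k] {V : Type*}
    {G : SimpleGraph V} (s : ℕ) {W : Set V} (hW : IsVertexCover G W) :
    jetsEdgeIdeal k G s ≤ jetsVertexCoverIdeal k s W := by
  refine Ideal.span_le.2 ?_
  rintro _ ⟨x, y, hxy, m, -, rfl⟩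
  refine Ideal.sum_mem _ fun ij _ => ?_
  rcases hW hxy with h | h
  · exact Ideal.mul_mem_right _ _ (Ideal.subset_span ⟨x, h, _, rfl⟩)
  · exact Ideal.mul_mem_left _ _ (Ideal.subset_span ⟨y, h, _, rfl⟩)

theorem X_notMem_jetsVertexCoverIdeal (k : Type*) [Field k] {V : Type*} (s : ℕ) {W : Set V}
    {y : V} (hy : y ∉ W) (i : Fin (s + 1)) :
    (X (y, i) : MvPolynomial (V × Fin (s + 1)) k) ∉ jetsVertexCoverIdeal k s W := by
  classical
  intro h
  let φ : MvPolynomial (V × Fin (s + 1)) k →+* k := eval fun v => if v.1 ∈ W then 0 else 1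
  have hle : jetsVertexCoverIdeal k s W ≤ RingHom.ker φ := by
    refine Ideal.span_le.2 ?_
    rintro _ ⟨x, hx, j, rfl⟩
    simp [φ, RingHom.mem_ker, hx]
  simpa [φ, RingHom.mem_ker, hy] using hle h

/-- Modulo the terms `X (x, j) * X (y, i - j)` with `j < i`, `α_i(x,y)` is `X (x, i) * X (y, 0)`. -/
theorem X_mul_X_zero_mem_of_jetsAlpha_mem {k : Type*} [Field k] {V : Type*} {s : ℕ} {x y : V}
    {Q : Ideal (MvPolynomial (V × Fin (s + 1)) k)} {i : Fin (s + 1)}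
    (hα : jetsAlpha k s x y i ∈ Q) (hlt : ∀ j < i, X (x, j) ∈ Q) :
    X (x, i) * X (y, 0) ∈ Q := by
  have hmem : (i, (0 : Fin (s + 1))) ∈ Finset.univ.filter
      (fun ij : Fin (s + 1) × Fin (s + 1) => (ij.1 : ℕ) + (ij.2 : ℕ) = i) := by simp
  rw [jetsAlpha, ← Finset.add_sum_erase _ _ hmem] at hα
  refine (Q.add_mem_iff_left (Q.sum_mem fun ij hij => ?_)).1 hα
  obtain ⟨hne, hsum⟩ : ij ≠ (i, 0) ∧ (ij.1 : ℕ) + (ij.2 : ℕ) = i := by simpa using hij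
  refine Q.mul_mem_right _ (hlt _ (lt_of_le_of_ne (Fin.le_def.2 (by omega)) fun h => hne ?_))
  refine Prod.ext h (Fin.ext ?_)
  have := congrArg Fin.val h
  simp only [Fin.val_zero]
  omega

theorem jetsVertexCoverIdeal_eq_contraction (k : Type*) [Field k]
    {V : Type*} [Fintype V] (G : SimpleGraph V) (s : ℕ) (W : Set V)
    (hW : IsMinimalVertexCover G W)
    (p : Ideal (MvPolynomial (V × Fin (s + 1)) k)) [hp : p.IsPrime]
    (hpeq : p = jetsVertexCoverIdeal k s W) :
    Ideal.comap
        (algebraMap (MvPolynomial (V × Fin (s + 1)) k) (Localization.AtPrime p))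
        (Ideal.map
          (algebraMap (MvPolynomial (V × Fin (s + 1)) k) (Localization.AtPrime p))
          (jetsEdgeIdeal k G s)) = jetsVertexCoverIdeal k s W := by
  subst hpeq
  apply le_antisymm
  · intro f hf
    have hf' := Ideal.comap_mono (Ideal.map_mono
      (jetsEdgeIdeal_le_jetsVertexCoverIdeal k s hW.1)) hf
    rw [Localization.AtPrime.map_eq_maximalIdeal] at hf'
    exact (IsLocalization.AtPrime.under_maximalIdeal _ (jetsVertexCoverIdeal k s W)).le hf'
  · refine Ideal.span_le.2 ?_
    rintro _ ⟨x, hx, i, rfl⟩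
    obtain ⟨y, hxy, hy⟩ := hW.exists_adj_notMem hx
    induction i using WellFoundedLT.induction with
    | ind i ih =>
      have hα : jetsAlpha k s x y i ∈ jetsEdgeIdeal k G s :=
        Ideal.subset_span ⟨x, y, hxy, i, Nat.lt_succ_iff.1 i.2, rfl⟩
      have h := X_mul_X_zero_mem_of_jetsAlpha_mem (Ideal.le_comap_map hα) ih
      rw [Ideal.mem_comap, map_mul] at h
      exact (Ideal.mul_unit_mem_iff_mem _ (IsLocalization.map_units
        (Localization.AtPrime (jetsVertexCoverIdeal k s W))
        (⟨X (y, 0), X_notMem_jetsVertexCoverIdeal k s hy 0⟩ :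
          (jetsVertexCoverIdeal k s W).primeCompl))).1 h
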